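/- arXiv:1703.08159 — 2 statements merged into one kernel-verified Lean document; each statement's English description precedes it below -/
import Mathlib

section
/- Let p>−1 be real, q complex, and α complex with 2α not an integer. Then for every x with 0<x<1, ϑ_α^{(p,q)}(x) = (1/2)·[ Q_{p,q}(α)·G_α^{(p,q)}(x) + Q_{p,q}(−α)·G_{−α}^{(p,q)}(x) ], where Q_{p,q}(α) = 2Γ(1+p)Γ(−2α) / [Γ((1+p+q)/2 − α)·Γ((1+p−q)/2 − α)]. -/
open scoped Real
open Complex MeasureTheory Set ComplexConjugate

noncomputable section

/-- Pochhammer symbol `(a)ₙ = a (a+1) ⋯ (a+n−1)`. -/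
def poch (a : ℂ) (n : ℕ) : ℂ := (ascPochhammer ℂ n).eval a

/-- Gauss hypergeometric series `₂F₁(a,b;c;z)`. -/
def hyp2F1 (a b c z : ℂ) : ℂ :=
  ∑' n : ℕ, poch a n * poch b n / (poch c n * (n.factorial : ℂ)) * z ^ n

/-- Jacobi function `ϑ_α^{(p,q)}(x)` on `0 < x < 1`. -/
def thetaJ (p q α : ℂ) (x : ℝ) : ℂ :=
  (x : ℂ) ^ ((1 + p + q) / 2 + α) *
    hyp2F1 ((1 + p + q) / 2 + α) ((1 + p - q) / 2 + α) (1 + p) (1 - (x : ℂ))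

/-- The pure-power solution `G_α^{(p,q)}(x)`. -/
def Gcb (p q α : ℂ) (x : ℝ) : ℂ :=
  (x : ℂ) ^ ((1 + p + q) / 2 + α) *
    hyp2F1 ((1 + p + q) / 2 + α) ((1 + p - q) / 2 + α) (1 + 2 * α) (x : ℂ)

/-- `Q_{p,q}(α)`. -/
def QJ (p q α : ℂ) : ℂ :=
  2 * Complex.Gamma (1 + p) * Complex.Gamma (-2 * α) /
    (Complex.Gamma ((1 + p + q) / 2 - α) * Complex.Gamma ((1 + p - q) / 2 - α))

open Filter Topology

/-- Coefficients of the Gauss hypergeometric series. -/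
def hypCoeff (a b c : ℂ) (n : ℕ) : ℂ :=
  poch a n * poch b n / (poch c n * (n.factorial : ℂ))

lemma poch_zero (a : ℂ) : poch a 0 = 1 := by simp [poch]

lemma poch_succ (a : ℂ) (n : ℕ) : poch a (n + 1) = poch a n * (a + n) := by
  simp [poch, ascPochhammer_succ_eval]

lemma poch_succ_left (a : ℂ) (n : ℕ) : poch a (n + 1) = a * poch (a + 1) n := by
  simp [poch, ascPochhammer_succ_left]

lemma poch_ne_zero {c : ℂ} (hc : ∀ n : ℕ, c ≠ -n) (n : ℕ) : poch c n ≠ 0 := by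
  induction n with
  | zero => simp [poch_zero]
  | succ n ih =>
    rw [poch_succ]
    exact mul_ne_zero ih fun h => hc n (eq_neg_of_add_eq_zero_left h)

lemma hypCoeff_zero (a b c : ℂ) : hypCoeff a b c 0 = 1 := by simp [hypCoeff, poch_zero]

lemma hypCoeff_succ (a b c : ℂ) (n : ℕ) :
    hypCoeff a b c (n + 1) = (a + n) * (b + n) / ((c + n) * (n + 1)) * hypCoeff a b c n := by
  simp only [hypCoeff, poch_succ, Nat.factorial_succ, Nat.cast_mul, Nat.cast_add, Nat.cast_one,
    div_eq_mul_inv, mul_inv]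
  ring

lemma hyp2F1_comm (a b c z : ℂ) : hyp2F1 a b c z = hyp2F1 b a c z := by
  simp only [hyp2F1, mul_comm (poch a _)]

lemma tendsto_add_natCast_div (a c : ℂ) :
    Tendsto (fun n : ℕ => (a + n) / (c + n)) atTop (𝓝 1) := by
  have h1 := tendsto_natCast_div_add_atTop (𝕜 := ℂ) c
  have h2 := (tendsto_natCast_div_add_atTop (𝕜 := ℂ) a).inv₀ one_ne_zero
  have h3 := h2.mul h1
  simp only [inv_one, mul_one] at h3
  refine h3.congr' ?_
  filter_upwards [eventually_ne_atTop 0] with n hn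
  have : (n : ℂ) ≠ 0 := Nat.cast_ne_zero.2 hn
  rw [inv_div, div_mul_div_comm, add_comm a, add_comm c, mul_comm (n : ℂ) (n + c),
    mul_div_mul_right _ _ this]

lemma summable_hypCoeff_mul_pow (a b c : ℂ) {z : ℂ} (hz : ‖z‖ < 1) :
    Summable fun n => hypCoeff a b c n * z ^ n := by
  obtain ⟨r, hr0, hr1⟩ := exists_between hz
  refine summable_of_ratio_norm_eventually_le hr1 ?_
  have h : Tendsto (fun n : ℕ => ‖(a + n) / (c + n) * ((b + n) / (1 + n)) * z‖) atTop
      (𝓝 ‖(1 : ℂ) * 1 * z‖) :=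
    (((tendsto_add_natCast_div a c).mul (tendsto_add_natCast_div b 1)).mul_const z).norm
  rw [one_mul, one_mul] at h
  filter_upwards [h.eventually_le_const hr0] with n hn
  have : hypCoeff a b c (n + 1) * z ^ (n + 1)
      = ((a + n) / (c + n) * ((b + n) / (1 + n)) * z) * (hypCoeff a b c n * z ^ n) := by
    rw [hypCoeff_succ, div_mul_div_comm, add_comm (1 : ℂ)]
    ring
  rw [this, norm_mul]
  gcongr

lemma hasSum_hyp2F1 (a b c : ℂ) {z : ℂ} (hz : ‖z‖ < 1) :
    HasSum (fun n => hypCoeff a b c n * z ^ n) (hyp2F1 a b c z) :=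
  (summable_hypCoeff_mul_pow a b c hz).hasSum

lemma hyp2F1_zero (a b c : ℂ) : hyp2F1 a b c 0 = 1 := by
  refine (hasSum_hyp2F1 a b c (z := 0) (by simp)).unique ?_
  convert hasSum_single (f := fun n : ℕ => hypCoeff a b c n * (0 : ℂ) ^ n) 0 ?_ using 1
  · simp [hypCoeff_zero]
  · intro n hn
    simp [hn]

lemma hasSum_natCast_mul_hypCoeff (a b c : ℂ) {z : ℂ} (hz : ‖z‖ < 1) :
    DifferentiableAt ℂ (hyp2F1 a b c) z ∧
      HasSum (fun n : ℕ => hypCoeff a b c n * (n * z ^ (n - 1))) (deriv (hyp2F1 a b c) z) := by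
  obtain ⟨r, hr0, hr1⟩ := exists_between hz
  have hrpos : 0 < r := (norm_nonneg z).trans_lt hr0
  have hu : Summable fun n => ‖hypCoeff a b c n * (r : ℂ) ^ n‖ :=
    (summable_hypCoeff_mul_pow a b c (z := (r : ℂ)) (by simpa [abs_of_pos hrpos])).norm
  have hd : ∀ n : ℕ, DifferentiableOn ℂ (fun w : ℂ => hypCoeff a b c n * w ^ n)
      (Metric.ball 0 r) := fun n => by fun_prop
  have hle : ∀ (n : ℕ) (w : ℂ), w ∈ Metric.ball (0 : ℂ) r →
      ‖hypCoeff a b c n * w ^ n‖ ≤ ‖hypCoeff a b c n * (r : ℂ) ^ n‖ := by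
    intro n w hw
    rw [mem_ball_zero_iff] at hw
    simp only [norm_mul, norm_pow, norm_real, Real.norm_eq_abs, abs_of_pos hrpos]
    gcongr
  have hmem : z ∈ Metric.ball (0 : ℂ) r := by simpa using hr0
  refine ⟨(differentiableOn_tsum_of_summable_norm hu hd Metric.isOpen_ball hle).differentiableAt
    (Metric.isOpen_ball.mem_nhds hmem), ?_⟩
  have := hasSum_deriv_of_summable_norm hu hd Metric.isOpen_ball hle hmem
  simpa [hyp2F1, hypCoeff] using! this

lemma hypCoeff_succ_mul (a b c : ℂ) (n : ℕ) :
    hypCoeff a b c (n + 1) * (n + 1) = a * b / c * hypCoeff (a + 1) (b + 1) (c + 1) n := by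
  have : (n : ℂ) + 1 ≠ 0 := Nat.cast_add_one_ne_zero n
  simp only [hypCoeff, poch_succ_left, Nat.factorial_succ, Nat.cast_mul, Nat.cast_add,
    Nat.cast_one, div_eq_mul_inv, mul_inv]
  field_simp

lemma hasDerivAt_hyp2F1 (a b c : ℂ) {z : ℂ} (hz : ‖z‖ < 1) :
    HasDerivAt (hyp2F1 a b c) (a * b / c * hyp2F1 (a + 1) (b + 1) (c + 1) z) z := by
  obtain ⟨hd, hs⟩ := hasSum_natCast_mul_hypCoeff a b c hz
  refine hd.hasDerivAt.congr_deriv ?_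
  refine HasSum.unique ?_ ((hasSum_hyp2F1 _ _ _ hz).mul_left _)
  rw [← hasSum_nat_add_iff' 1] at hs
  simp only [Finset.range_one, Finset.sum_singleton, Nat.cast_zero, zero_mul, mul_zero,
    sub_zero, Nat.add_sub_cancel] at hs
  convert! hs using 2 with n
  rw [← mul_assoc, ← hypCoeff_succ_mul]
  push_cast
  ring

/-- The series for the Euler operator: coefficients `n tₙ`. -/
lemma hasSum_mul_deriv_hyp2F1 (a b c : ℂ) {z : ℂ} (hz : ‖z‖ < 1) :
    HasSum (fun n : ℕ => n * (hypCoeff a b c n * z ^ n))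
      (z * (a * b / c * hyp2F1 (a + 1) (b + 1) (c + 1) z)) := by
  have hs := (hasSum_natCast_mul_hypCoeff a b c hz).2
  rw [(hasDerivAt_hyp2F1 a b c hz).deriv] at hs
  convert! hs.mul_left z using 2 with n
  cases n with
  | zero => simp
  | succ n => rw [Nat.add_sub_cancel, pow_succ]; ring

/-- The contiguous relation lowering the third parameter. -/
lemma hyp2F1_contiguous (a b c : ℂ) (hc : ∀ n : ℕ, c ≠ -n) {z : ℂ} (hz : ‖z‖ < 1) :
    c * hyp2F1 a b (c + 1) z
      + z * (a * b / (c + 1) * hyp2F1 (a + 1) (b + 1) (c + 1 + 1) z) = c * hyp2F1 a b c z := by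
  refine HasSum.unique (((hasSum_hyp2F1 a b (c + 1) hz).mul_left c).add
    (hasSum_mul_deriv_hyp2F1 a b (c + 1) hz)) ?_
  convert (hasSum_hyp2F1 a b c hz).mul_left c using 2 with n
  have h0 := poch_ne_zero hc n
  have h1 := poch_succ c n
  rw [poch_succ_left] at h1
  have hc0 : c ≠ 0 := by simpa using hc 0
  have h2 := poch_ne_zero hc (n + 1)
  rw [poch_succ_left] at h2
  have h3 := right_ne_zero_of_mul h2
  have h4 : (n.factorial : ℂ) ≠ 0 := Nat.cast_ne_zero.2 n.factorial_ne_zero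
  simp only [hypCoeff]
  field_simp
  linear_combination -(poch a n * poch b n * z ^ n) * h1

/-- The hypergeometric equation in terms of contiguous functions. -/
lemma hyp2F1_ode (a b c : ℂ) (hc : ∀ n : ℕ, c ≠ -n) {z : ℂ} (hz : ‖z‖ < 1) :
    z * (1 - z) * (a * b / c * ((a + 1) * (b + 1) / (c + 1) *
        hyp2F1 (a + 1 + 1) (b + 1 + 1) (c + 1 + 1) z))
      + (c - (a + b + 1) * z) * (a * b / c * hyp2F1 (a + 1) (b + 1) (c + 1) z)
      - a * b * hyp2F1 a b c z = 0 := by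
  have hc0 : c ≠ 0 := by simpa using hc 0
  set G := hyp2F1 (a + 1) (b + 1) (c + 1) z
  set G' := (a + 1) * (b + 1) / (c + 1) * hyp2F1 (a + 1 + 1) (b + 1 + 1) (c + 1 + 1) z
  have hG := hasSum_hyp2F1 (a + 1) (b + 1) (c + 1) hz
  have hG' := hasSum_mul_deriv_hyp2F1 (a + 1) (b + 1) (c + 1) hz
  have hF := (hasSum_hyp2F1 a b c hz).mul_left c
  have h1 := hG'.add (hG.mul_left c)
  have h2 := (hG'.add (hG.mul_left (a + b + 1))).mul_left z
  rw [← hasSum_nat_add_iff' 1] at h1 hF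
  have key := h1.sub h2
  simp only [Finset.range_one, Finset.sum_singleton, hypCoeff_zero, pow_zero, Nat.cast_zero,
    zero_add, mul_one] at key hF
  have := key.unique (by
    convert hF using 2 with n
    have e1 := hypCoeff_succ (a + 1) (b + 1) (c + 1) n
    have e2 := hypCoeff_succ_mul a b c n
    have e3 := hypCoeff_succ a b c n
    have h1 : (n : ℂ) + 1 ≠ 0 := Nat.cast_add_one_ne_zero n
    have h2 : c + 1 + n ≠ 0 := fun h => hc (n + 1) (by push_cast; linear_combination h)
    rw [eq_div_of_mul_eq h1 e2, e1]
    push_cast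
    field_simp
    ring)
  simp only [G, G'] at *
  linear_combination (a * b / c) * this + a * b * hyp2F1 a b c z * mul_inv_cancel₀ hc0

lemma cpow_eq_cpow_sub_one_mul {z : ℂ} (hz : z ≠ 0) (τ : ℂ) : z ^ τ = z ^ (τ - 1) * z := by
  rw [cpow_sub _ _ hz, cpow_one, div_mul_cancel₀ _ hz]

/-- A function with given first and second derivatives solves the hypergeometric equation
with parameters `a, b, c` on `S`. -/
def IsHypSol (a b c : ℂ) (S : Set ℂ) (y y' y'' : ℂ → ℂ) : Prop :=
  ∀ z ∈ S, HasDerivAt y (y' z) z ∧ HasDerivAt y' (y'' z) z ∧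
    z * (1 - z) * y'' z + (c - (a + b + 1) * z) * y' z - a * b * y z = 0

lemma IsHypSol.mono {a b c : ℂ} {S T : Set ℂ} {y y' y'' : ℂ → ℂ}
    (h : IsHypSol a b c S y y' y'') (hT : T ⊆ S) : IsHypSol a b c T y y' y'' :=
  fun z hz => h z (hT hz)

lemma isHypSol_hyp2F1 (a b c : ℂ) (hc : ∀ n : ℕ, c ≠ -n) :
    IsHypSol a b c (Metric.ball 0 1) (hyp2F1 a b c)
      (fun z => a * b / c * hyp2F1 (a + 1) (b + 1) (c + 1) z)
      (fun z => a * b / c * ((a + 1) * (b + 1) / (c + 1) *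
        hyp2F1 (a + 1 + 1) (b + 1 + 1) (c + 1 + 1) z)) := by
  intro z hz
  rw [mem_ball_zero_iff] at hz
  exact ⟨hasDerivAt_hyp2F1 a b c hz, (hasDerivAt_hyp2F1 _ _ _ hz).const_mul _,
    hyp2F1_ode a b c hc hz⟩

lemma IsHypSol.reflect {a b c c' : ℂ} {S T : Set ℂ} {y y' y'' : ℂ → ℂ}
    (h : IsHypSol a b c S y y' y'') (hT : ∀ z ∈ T, 1 - z ∈ S) (hc : c' = a + b + 1 - c) :
    IsHypSol a b c' T (fun z => y (1 - z)) (fun z => -y' (1 - z)) (fun z => y'' (1 - z)) := by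
  intro z hz
  obtain ⟨h1, h2, h3⟩ := h _ (hT z hz)
  have hd : HasDerivAt (fun w : ℂ => 1 - w) (-1) z := by
    simpa using (hasDerivAt_id z).const_sub 1
  refine ⟨?_, ?_, ?_⟩
  · exact (h1.comp z hd).congr_deriv (by ring)
  · exact (h2.comp z hd).neg.congr_deriv (by ring)
  · subst hc
    linear_combination h3

lemma IsHypSol.cpow_mul {a b c a' b' c' σ : ℂ} {S : Set ℂ} {y y' y'' : ℂ → ℂ}
    (h : IsHypSol a b c S y y' y'') (hS : S ⊆ slitPlane) (ha : a' = a - σ) (hb : b' = b - σ)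
    (hc : c' = 2 - c) (hσ : σ = c - 1) :
    IsHypSol a' b' c' S (fun z => z ^ σ * y z)
      (fun z => σ * z ^ (σ - 1) * y z + z ^ σ * y' z)
      (fun z => σ * ((σ - 1) * z ^ (σ - 1 - 1)) * y z + σ * z ^ (σ - 1) * y' z +
        (σ * z ^ (σ - 1) * y' z + z ^ σ * y'' z)) := by
  intro z hz
  obtain ⟨h1, h2, h3⟩ := h z hz
  have hzs := hS hz
  have hz0 : z ≠ 0 := slitPlane_ne_zero hzs
  have hp : ∀ τ : ℂ, HasDerivAt (fun w : ℂ => w ^ τ) (τ * z ^ (τ - 1)) z := fun τ => by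
    simpa using (hasDerivAt_id z).cpow_const (c := τ) hzs
  refine ⟨(hp σ).mul h1, (((hp (σ - 1)).const_mul σ).mul h1).add ((hp σ).mul h2), ?_⟩
  have e1 : z ^ (σ - 1) = z ^ (σ - 1 - 1) * z :=
    cpow_eq_cpow_sub_one_mul hz0 _
  have e2 : z ^ σ = z ^ (σ - 1 - 1) * z * z := by
    rw [← e1, ← cpow_eq_cpow_sub_one_mul hz0]
  beta_reduce
  rw [e2, e1]
  have hc1 : c = σ + 1 := by rw [hσ]; ring
  subst ha hb hc
  rw [hc1] at h3 ⊢
  linear_combination z ^ (σ - 1 - 1) * z * z * h3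

/-- The Wronskian of two functions, normalised so as to be constant for solutions of the
hypergeometric equation. -/
def hypWronskian (a b c : ℂ) (y y' w w' : ℂ → ℂ) (z : ℂ) : ℂ :=
  z ^ c * (1 - z) ^ (a + b + 1 - c) * (y z * w' z - y' z * w z)

/-- The lens `|z| < 1`, `|1 - z| < 1`. -/
def lens : Set ℂ := Metric.ball 0 1 ∩ Metric.ball 1 1

lemma mem_slitPlane_of_mem_ball_one {z : ℂ} (hz : z ∈ Metric.ball (1 : ℂ) 1) :
    z ∈ slitPlane := by
  rw [Metric.mem_ball, dist_eq_norm] at hz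
  have h := (neg_abs_le _).trans' (neg_le_neg (abs_re_le_norm (z - 1)))
  simp only [sub_re, one_re] at h
  exact Or.inl (by linarith)

lemma one_sub_mem_ball_one {z : ℂ} (hz : z ∈ Metric.ball (0 : ℂ) 1) :
    1 - z ∈ Metric.ball (1 : ℂ) 1 := by
  simpa [dist_eq_norm] using hz

lemma one_sub_mem_ball_zero {z : ℂ} (hz : z ∈ Metric.ball (1 : ℂ) 1) :
    1 - z ∈ Metric.ball (0 : ℂ) 1 := by
  simpa [dist_eq_norm, norm_sub_rev] using hz

lemma one_sub_mem_lens {z : ℂ} (hz : z ∈ lens) : 1 - z ∈ lens :=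
  ⟨one_sub_mem_ball_zero hz.2, one_sub_mem_ball_one hz.1⟩

lemma isOpen_lens : IsOpen lens := Metric.isOpen_ball.inter Metric.isOpen_ball

lemma ofReal_mem_lens {x : ℝ} (hx : x ∈ Ioo (0 : ℝ) 1) : (x : ℂ) ∈ lens := by
  constructor
  · simpa [abs_of_pos hx.1] using hx.2
  · rw [Metric.mem_ball, dist_eq_norm, ← ofReal_one, ← ofReal_sub, norm_real, Real.norm_eq_abs,
      abs_sub_lt_iff]
    constructor <;> linarith [hx.1, hx.2]

lemma hypWronskian_const {a b c : ℂ} {y y' y'' w w' w'' : ℂ → ℂ}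
    (hy : IsHypSol a b c lens y y' y'') (hw : IsHypSol a b c lens w w' w'') :
    ∃ k, ∀ z ∈ lens, hypWronskian a b c y y' w w' z = k := by
  have key : ∀ z ∈ lens, HasDerivAt (hypWronskian a b c y y' w w') 0 z := by
    intro z hz
    obtain ⟨hy1, hy2, hy3⟩ := hy z hz
    obtain ⟨hw1, hw2, hw3⟩ := hw z hz
    have hs0 := mem_slitPlane_of_mem_ball_one hz.2
    have hs1 := mem_slitPlane_of_mem_ball_one (one_sub_mem_ball_one hz.1)
    have hd : HasDerivAt (fun w : ℂ => 1 - w) (-1) z := by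
      simpa using (hasDerivAt_id z).const_sub 1
    have hp : HasDerivAt (fun w : ℂ => w ^ c) (c * z ^ (c - 1)) z := by
      simpa using (hasDerivAt_id z).cpow_const (c := c) hs0
    have hq : HasDerivAt (fun w : ℂ => (1 - w) ^ (a + b + 1 - c))
        ((a + b + 1 - c) * (1 - z) ^ (a + b + 1 - c - 1) * (-1)) z :=
      hd.cpow_const hs1
    refine ((hp.mul hq).mul ((hy1.mul hw2).sub (hy2.mul hw1))).congr_deriv ?_
    have e1 : z ^ c = z ^ (c - 1) * z :=
      cpow_eq_cpow_sub_one_mul (slitPlane_ne_zero hs0) _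
    have e2 : (1 - z) ^ (a + b + 1 - c) = (1 - z) ^ (a + b + 1 - c - 1) * (1 - z) :=
      cpow_eq_cpow_sub_one_mul (slitPlane_ne_zero hs1) _
    simp only [Pi.mul_apply, Pi.sub_apply]
    rw [e1, e2]
    linear_combination z ^ (c - 1) * (1 - z) ^ (a + b + 1 - c - 1) * (y z * hw3 - w z * hy3)
  exact isOpen_lens.exists_is_const_of_deriv_eq_zero
    ((convex_ball _ _).inter (convex_ball _ _)).isPreconnected
    (fun z hz => (key z hz).differentiableAt.differentiableWithinAt)
    (fun z hz => (key z hz).deriv)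

/-- A solution analytic at the origin and vanishing there vanishes identically. -/
lemma IsHypSol.eqOn_zero {a b c : ℂ} (hc : ∀ n : ℕ, c ≠ -n) {y y' y'' : ℂ → ℂ}
    (h : IsHypSol a b c (Metric.ball 0 1) y y' y'') (h0 : y 0 = 0) :
    ∀ z ∈ Metric.ball (0 : ℂ) 1, y z = 0 := by
  have hb : Metric.ball (0 : ℂ) 1 ∈ 𝓝 (0 : ℂ) := Metric.ball_mem_nhds _ one_pos
  have han : AnalyticOnNhd ℂ y (Metric.ball 0 1) :=
    DifferentiableOn.analyticOnNhd (fun z hz => (h z hz).1.differentiableAt.differentiableWithinAt)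
      Metric.isOpen_ball
  have h00 : (0 : ℂ) ∈ Metric.ball (0 : ℂ) 1 := by simp
  refine han.eqOn_zero_of_preconnected_of_eventuallyEq_zero (convex_ball _ _).isPreconnected
    h00 ?_
  by_contra hne
  obtain ⟨m, k, hk, hk0, hyk⟩ := (han 0 h00).exists_eventuallyEq_pow_smul_nonzero_iff.2 hne
  simp only [sub_zero, smul_eq_mul] at hyk
  obtain _ | j := m
  · exact hk0 (by simpa [h0] using hyk.self_of_nhds.symm)
  set K : ℂ → ℂ := fun z => (j + 1) * k z + z * deriv k z with hK
  have hKan : AnalyticAt ℂ K 0 := by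
    have := hk.deriv
    fun_prop
  have hy' : ∀ᶠ z in 𝓝 (0 : ℂ), y' z = z ^ j * K z := by
    filter_upwards [hyk.eventually_nhds, hb, hk.eventually_analyticAt] with z hz hzb hkz
    have hd := ((hasDerivAt_pow (j + 1) z).mul hkz.differentiableAt.hasDerivAt).congr_of_eventuallyEq
      (f₁ := y) hz
    rw [(h z hzb).1.unique hd]
    simp only [hK, Nat.add_sub_cancel]
    push_cast
    ring
  have hy'' : ∀ᶠ z in 𝓝 (0 : ℂ), z * y'' z = z ^ j * (j * K z + z * deriv K z) := by
    filter_upwards [hy'.eventually_nhds, hb, hKan.eventually_analyticAt] with z hz hzb hkz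
    have hd := ((hasDerivAt_pow j z).mul hkz.differentiableAt.hasDerivAt).congr_of_eventuallyEq
      (f₁ := y') hz
    rw [(h z hzb).2.1.unique hd]
    cases j with
    | zero => simp
    | succ j =>
      simp only [Nat.add_sub_cancel]
      push_cast
      ring
  set R : ℂ → ℂ := fun z => (1 - z) * (j * K z + z * deriv K z) +
    (c - (a + b + 1) * z) * K z - a * b * (z * k z) with hR
  have hRan : AnalyticAt ℂ R 0 := by
    have := hKan.deriv
    fun_prop
  have hR0 : ∀ᶠ z in 𝓝[≠] (0 : ℂ), R z = 0 := by
    filter_upwards [hyk.filter_mono nhdsWithin_le_nhds, hy'.filter_mono nhdsWithin_le_nhds,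
      hy''.filter_mono nhdsWithin_le_nhds, mem_nhdsWithin_of_mem_nhds hb,
      self_mem_nhdsWithin] with z h1 h2 h3 hzb hz0
    have h4 := (h z hzb).2.2
    rw [h1, h2] at h4
    refine (mul_eq_zero.1 ?_).resolve_left (pow_ne_zero j (show z ≠ 0 from hz0))
    simp only [hR]
    linear_combination h4 - (1 - z) * h3
  have hlim := hRan.continuousAt.continuousWithinAt (s := {0}ᶜ)
  have hR00 : R 0 = 0 :=
    tendsto_nhds_unique hlim (tendsto_const_nhds.congr' (hR0.mono fun z hz => hz.symm))
  simp only [hR, hK, zero_mul, mul_zero, sub_zero, one_mul, add_zero] at hR00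
  have : ((j : ℂ) + c) * ((j + 1) * k 0) = 0 := by linear_combination hR00
  rcases mul_eq_zero.1 this with h' | h'
  · exact hc j (by linear_combination h')
  · exact (mul_ne_zero (Nat.cast_add_one_ne_zero j) hk0) h'

lemma IsHypSol.sub {a b c : ℂ} {S : Set ℂ} {y y' y'' w w' w'' : ℂ → ℂ}
    (hy : IsHypSol a b c S y y' y'') (hw : IsHypSol a b c S w w' w'') :
    IsHypSol a b c S (fun z => y z - w z) (fun z => y' z - w' z) (fun z => y'' z - w'' z) :=
  fun z hz => ⟨(hy z hz).1.sub (hw z hz).1, (hy z hz).2.1.sub (hw z hz).2.1, by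
    linear_combination (hy z hz).2.2 - (hw z hz).2.2⟩

/-- The Euler transformation. -/
lemma hyp2F1_euler (a b c : ℂ) (hc : ∀ n : ℕ, c ≠ -n) {z : ℂ} (hz : z ∈ Metric.ball (0 : ℂ) 1) :
    hyp2F1 a b c z = (1 - z) ^ (c - a - b) * hyp2F1 (c - a) (c - b) c z := by
  have h1 := (isHypSol_hyp2F1 (c - a) (c - b) c hc).reflect (T := Metric.ball 1 1)
    (fun z hz => one_sub_mem_ball_zero hz) rfl
  have h2 := h1.cpow_mul (a' := b) (b' := a) (σ := c - a - b)
    (fun z hz => mem_slitPlane_of_mem_ball_one hz) (by ring) (by ring) rfl (by ring)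
  have h3 := h2.reflect (c' := c) (T := Metric.ball 0 1) (fun z hz => one_sub_mem_ball_one hz)
    (by ring)
  have h4 := (isHypSol_hyp2F1 b a c hc).sub h3
  have h5 := h4.eqOn_zero hc (by simp [hyp2F1_zero]) z hz
  rw [hyp2F1_comm, sub_eq_zero.1 h5]
  simp

lemma lens_subset_ball : lens ⊆ Metric.ball 0 1 := inter_subset_left

/-- The two Frobenius solutions at the origin, with their derivatives, have normalised
Wronskian `σ`. -/
lemma exists_frobenius_basis (a b c σ : ℂ) (hσ : ∀ n : ℤ, σ ≠ n) (hc : c = 1 - σ) :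
    ∃ v'' : ℂ → ℂ, IsHypSol a b c lens (fun z => z ^ σ * hyp2F1 (a + σ) (b + σ) (1 + σ) z)
        (fun z => σ * z ^ (σ - 1) * hyp2F1 (a + σ) (b + σ) (1 + σ) z + z ^ σ *
          ((a + σ) * (b + σ) / (1 + σ) * hyp2F1 (a + σ + 1) (b + σ + 1) (1 + σ + 1) z)) v'' ∧
      ∀ z ∈ lens, hypWronskian a b c (hyp2F1 a b c)
        (fun z => a * b / c * hyp2F1 (a + 1) (b + 1) (c + 1) z)
        (fun z => z ^ σ * hyp2F1 (a + σ) (b + σ) (1 + σ) z)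
        (fun z => σ * z ^ (σ - 1) * hyp2F1 (a + σ) (b + σ) (1 + σ) z + z ^ σ *
          ((a + σ) * (b + σ) / (1 + σ) * hyp2F1 (a + σ + 1) (b + σ + 1) (1 + σ + 1) z)) z = σ := by
  have hc' : ∀ n : ℕ, c ≠ -n := fun n h => hσ (n + 1) (by push_cast; linear_combination -h + hc)
  have hσ' : ∀ n : ℕ, 1 + σ ≠ -n := fun n h => hσ (-n - 1) (by push_cast; linear_combination h)
  have hv := ((isHypSol_hyp2F1 (a + σ) (b + σ) (1 + σ) hσ').mono lens_subset_ball).cpow_mul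
    (a' := a) (b' := b) (c' := c) (σ := σ) (fun z hz => mem_slitPlane_of_mem_ball_one hz.2)
    (by ring) (by ring) (by rw [hc]; ring) (by ring)
  refine ⟨_, hv, ?_⟩
  have hu := (isHypSol_hyp2F1 a b c hc').mono lens_subset_ball
  obtain ⟨k, hk⟩ := hypWronskian_const hu hv
  set w := hyp2F1 (a + σ) (b + σ) (1 + σ)
  set w' := fun z => (a + σ) * (b + σ) / (1 + σ) * hyp2F1 (a + σ + 1) (b + σ + 1) (1 + σ + 1) z
    with hw'
  set u := hyp2F1 a b c
  set u' := fun z => a * b / c * hyp2F1 (a + 1) (b + 1) (c + 1) z with hu'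
  set g : ℂ → ℂ := fun z => (1 - z) ^ (a + b + 1 - c) *
    (u z * (σ * w z + z * w' z) - u' z * (z * w z)) with hg
  have hgk : ∀ z ∈ lens, g z = k := by
    intro z hz
    rw [← hk z hz]
    have hz0 : z ≠ 0 := slitPlane_ne_zero (mem_slitPlane_of_mem_ball_one hz.2)
    have e1 : z ^ c * z ^ (σ - 1) = 1 := by
      rw [← cpow_add _ _ hz0, hc, show 1 - σ + (σ - 1) = 0 by ring, cpow_zero]
    have e2 := cpow_eq_cpow_sub_one_mul hz0 σ
    simp only [hypWronskian, hg]
    rw [e2]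
    linear_combination -(1 - z) ^ (a + b + 1 - c) *
      (u z * (σ * w z + z * w' z) - u' z * (z * w z)) * e1
  have hc0 : ∀ a b c : ℂ, ContinuousAt (hyp2F1 a b c) 0 := fun a b c =>
    (hasDerivAt_hyp2F1 a b c (by simp)).continuousAt
  have hgc : ContinuousAt g 0 := by
    have h1 : ContinuousAt (fun z : ℂ => (1 - z) ^ (a + b + 1 - c)) 0 :=
      (((hasDerivAt_id (0 : ℂ)).const_sub 1).cpow_const (by simp)).continuousAt
    have h2 := hc0 a b c
    have h3 := hc0 (a + σ) (b + σ) (1 + σ)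
    have h4 := hc0 (a + 1) (b + 1) (c + 1)
    have h5 := hc0 (a + σ + 1) (b + σ + 1) (1 + σ + 1)
    fun_prop
  have hgc' : ContinuousAt g ((0 : ℝ) : ℂ) := by rwa [ofReal_zero]
  have hlim : Tendsto (fun x : ℝ => g x) (𝓝[>] 0) (𝓝 (g ((0 : ℝ) : ℂ))) :=
    (hgc'.tendsto.comp (continuous_ofReal.tendsto 0)).mono_left nhdsWithin_le_nhds
  have hconst : (fun x : ℝ => g x) =ᶠ[𝓝[>] 0] fun _ => k := by
    filter_upwards [Ioo_mem_nhdsGT (zero_lt_one' ℝ)] with x hx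
    exact hgk _ (ofReal_mem_lens hx)
  have : g ((0 : ℝ) : ℂ) = k := tendsto_nhds_unique hlim (tendsto_const_nhds.congr' hconst.symm)
  intro z hz
  rw [hk z hz, ← this]
  simp [hg, u, w, hyp2F1_zero]

/-- The solution `(1 - z) ^ (c - 1) F(a, b; c; 1 - z)`. -/
def solOne (a b c z : ℂ) : ℂ := (1 - z) ^ (c - 1) * hyp2F1 a b c (1 - z)

/-- The derivative of `solOne`. -/
def solOneDeriv (a b c z : ℂ) : ℂ :=
  -((c - 1) * (1 - z) ^ (c - 1 - 1) * hyp2F1 a b c (1 - z) +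
    (1 - z) ^ (c - 1) * (a * b / c * hyp2F1 (a + 1) (b + 1) (c + 1) (1 - z)))

/-- The solution regular at the origin. -/
def solReg (a b c s z : ℂ) : ℂ := hyp2F1 (a - c + 1) (b - c + 1) (1 - s) z

/-- The solution with exponent `s` at the origin. -/
def solPow (a b s z : ℂ) : ℂ := z ^ s * hyp2F1 (1 - b) (1 - a) (1 + s) z

/-- The derivative of `solPow`. -/
def solPowDeriv (a b s z : ℂ) : ℂ :=
  s * z ^ (s - 1) * hyp2F1 (1 - b) (1 - a) (1 + s) z + z ^ s *
    ((1 - b) * (1 - a) / (1 + s) * hyp2F1 (1 - b + 1) (1 - a + 1) (1 + s + 1) z)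

/-- The derivative of `solReg`. -/
def solRegDeriv (a b c s z : ℂ) : ℂ :=
  (a - c + 1) * (b - c + 1) / (1 - s) * hyp2F1 (a - c + 1 + 1) (b - c + 1 + 1) (1 - s + 1) z

lemma exists_solPow (a b c s : ℂ) (hs : ∀ n : ℤ, s ≠ n) (hsc : s = c - a - b) :
    ∃ v'' : ℂ → ℂ, IsHypSol (a - c + 1) (b - c + 1) (1 - s) lens (solPow a b s)
        (solPowDeriv a b s) v'' ∧
      ∀ z ∈ lens, hypWronskian (a - c + 1) (b - c + 1) (1 - s) (solReg a b c s)
        (solRegDeriv a b c s) (solPow a b s) (solPowDeriv a b s) z = s := by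
  have h := exists_frobenius_basis (a - c + 1) (b - c + 1) (1 - s) s hs rfl
  have e1 : a - c + 1 + s = 1 - b := by rw [hsc]; ring
  have e2 : b - c + 1 + s = 1 - a := by rw [hsc]; ring
  rw [e1, e2] at h
  exact h

lemma isHypSol_solReg (a b c s : ℂ) (hs : ∀ n : ℤ, s ≠ n) :
    ∃ u'' : ℂ → ℂ, IsHypSol (a - c + 1) (b - c + 1) (1 - s) lens (solReg a b c s)
        (solRegDeriv a b c s) u'' :=
  ⟨_, (isHypSol_hyp2F1 _ _ _ fun n h =>
    hs (n + 1) (by push_cast; linear_combination -h)).mono lens_subset_ball⟩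

lemma exists_solOne (a b c s : ℂ) (hc : ∀ n : ℕ, c ≠ -n) (hsc : s = c - a - b) :
    ∃ y'' : ℂ → ℂ, IsHypSol (a - c + 1) (b - c + 1) (1 - s) lens (solOne a b c)
        (solOneDeriv a b c) y'' := by
  have h := ((isHypSol_hyp2F1 a b c hc).mono lens_subset_ball).cpow_mul
    (a' := a - c + 1) (b' := b - c + 1) (c' := 2 - c) (σ := c - 1)
    (fun z hz => mem_slitPlane_of_mem_ball_one hz.2) (by ring) (by ring) rfl rfl
  exact ⟨_, h.reflect (c' := 1 - s) (fun z hz => one_sub_mem_lens hz) (by rw [hsc]; ring)⟩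

lemma sol_independent {a b c s A B : ℂ} (hs : ∀ n : ℤ, s ≠ n) (hsc : s = c - a - b)
    (h : ∀ z ∈ lens, A * solReg a b c s z + B * solPow a b s z = 0) : A = 0 ∧ B = 0 := by
  obtain ⟨v'', hv, hW⟩ := exists_solPow a b c s hs hsc
  obtain ⟨u'', hu⟩ := isHypSol_solReg a b c s hs
  have hs0 : s ≠ 0 := by simpa using hs 0
  have hz : ((1 / 2 : ℝ) : ℂ) ∈ lens := ofReal_mem_lens ⟨by norm_num, by norm_num⟩
  set z := ((1 / 2 : ℝ) : ℂ)
  have h1 := h z hz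
  have h2 : A * solRegDeriv a b c s z + B * solPowDeriv a b s z = 0 := by
    refine HasDerivAt.unique (((hu z hz).1.const_mul A).add ((hv z hz).1.const_mul B)) ?_
    refine (hasDerivAt_const z (0 : ℂ)).congr_of_eventuallyEq ?_
    filter_upwards [isOpen_lens.mem_nhds hz] with w hw using h w hw
  have h3 := hW z hz
  simp only [hypWronskian] at h3
  set P := z ^ (1 - s) * (1 - z) ^ (a - c + 1 + (b - c + 1) + 1 - (1 - s))
  constructor
  · refine (mul_eq_zero.1 (?_ : s * A = 0)).resolve_left hs0
    linear_combination (-A) * h3 + P * solPowDeriv a b s z * h1 - P * solPow a b s z * h2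
  · refine (mul_eq_zero.1 (?_ : s * B = 0)).resolve_left hs0
    linear_combination (-B) * h3 + P * solReg a b c s z * h2 - P * solRegDeriv a b c s z * h1

/-- `solOne` has connection coefficient `A` along `solReg`. -/
def HasConn (a b c s A : ℂ) : Prop :=
  ∃ B : ℂ, ∀ z ∈ lens, solOne a b c z = A * solReg a b c s z + B * solPow a b s z

lemma HasConn.unique {a b c s A A' : ℂ} (hs : ∀ n : ℤ, s ≠ n) (hsc : s = c - a - b)
    (h : HasConn a b c s A) (h' : HasConn a b c s A') : A = A' := by
  obtain ⟨B, hB⟩ := h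
  obtain ⟨B', hB'⟩ := h'
  refine sub_eq_zero.1 (sol_independent (B := B - B') hs hsc fun z hz => ?_).1
  linear_combination hB' z hz - hB z hz

/-- The connection coefficient as a Wronskian evaluated at `1 / 2`. -/
def connHalf (a b c s : ℂ) : ℂ :=
  1 / 2 * hyp2F1 a b c (1 / 2) * (hyp2F1 (1 - b) (1 - a) (1 + s) (1 / 2) + 1 / 2 *
    ((1 - b) * (1 - a) / (1 + s) * hyp2F1 (1 - b + 1) (1 - a + 1) (1 + s + 1) (1 / 2)) / s) +
  ((c - 1) / s * hyp2F1 a b c (1 / 2) +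
    1 / 2 * (a * b / c * hyp2F1 (a + 1) (b + 1) (c + 1) (1 / 2)) / s) *
    (1 / 2 * hyp2F1 (1 - b) (1 - a) (1 + s) (1 / 2))

lemma hasConn_connHalf (a b c s : ℂ) (hc : ∀ n : ℕ, c ≠ -n) (hs : ∀ n : ℤ, s ≠ n)
    (hsc : s = c - a - b) : HasConn a b c s (connHalf a b c s) := by
  obtain ⟨v'', hv, hW⟩ := exists_solPow a b c s hs hsc
  obtain ⟨u'', hu⟩ := isHypSol_solReg a b c s hs
  obtain ⟨y'', hy⟩ := exists_solOne a b c s hc hsc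
  have hs0 : s ≠ 0 := by simpa using hs 0
  obtain ⟨k, hk⟩ := hypWronskian_const hy hv
  obtain ⟨l, hl⟩ := hypWronskian_const hy hu
  have hkA : k = s * connHalf a b c s := by
    have hz : (1 / 2 : ℂ) ∈ lens := by
      simpa using ofReal_mem_lens (x := 1 / 2) ⟨by norm_num, by norm_num⟩
    rw [← hk _ hz]
    have hh : (1 / 2 : ℂ) ≠ 0 := by norm_num
    have e1 : (1 / 2 : ℂ) ^ (1 - s) * (1 / 2) ^ (s - 1) = 1 := by
      rw [← cpow_add _ _ hh, show 1 - s + (s - 1) = 0 by ring, cpow_zero]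
    have e2 := cpow_eq_cpow_sub_one_mul hh s
    have e3 : (1 / 2 : ℂ) ^ (2 - c) * (1 / 2) ^ (c - 1 - 1) = 1 := by
      rw [← cpow_add _ _ hh, show 2 - c + (c - 1 - 1) = 0 by ring, cpow_zero]
    have e4 := cpow_eq_cpow_sub_one_mul hh (c - 1)
    have e5 : a - c + 1 + (b - c + 1) + 1 - (1 - s) = 2 - c := by rw [hsc]; ring
    have e6 : (1 : ℂ) - 1 / 2 = 1 / 2 := by norm_num
    simp only [hypWronskian, solOne, solOneDeriv, solPow, solPowDeriv, connHalf]
    rw [e5, e6, e2, e4]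
    generalize (1 / 2 : ℂ) ^ (1 - s) = X at *
    generalize (1 / 2 : ℂ) ^ (s - 1) = X' at *
    generalize (1 / 2 : ℂ) ^ (2 - c) = Y at *
    generalize (1 / 2 : ℂ) ^ (c - 1 - 1) = Y' at *
    generalize hyp2F1 a b c (1 / 2) = F
    generalize hyp2F1 (1 - b) (1 - a) (1 + s) (1 / 2) = w
    generalize (1 - b) * (1 - a) / (1 + s) *
      hyp2F1 (1 - b + 1) (1 - a + 1) (1 + s + 1) (1 / 2) = w'
    generalize a * b / c * hyp2F1 (a + 1) (b + 1) (c + 1) (1 / 2) = F'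
    field_simp
    linear_combination (Y * Y' * (2 * s * F * w + F * w' + 2 * (c - 1) * F * w + F' * w)) * e1
      + (2 * s * F * w + F * w' + 2 * (c - 1) * F * w + F' * w) * e3
  refine ⟨-l / s, fun z hz => ?_⟩
  have h1 := hW z hz
  have h2 := hk z hz
  have h3 := hl z hz
  rw [hkA] at h2
  simp only [hypWronskian] at h1 h2 h3
  field_simp
  linear_combination (-solOne a b c z) * h1 + solReg a b c s z * h2 - solPow a b s z * h3

lemma HasConn.of_succ {a b c s A : ℂ} (hc : ∀ n : ℕ, c ≠ -n) (hs : ∀ n : ℤ, s ≠ n)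
    (h : HasConn a b (c + 1) (s + 1) A) :
    HasConn a b c s (A * ((c - a) * (c - b) / (c * s))) := by
  obtain ⟨B, hB⟩ := h
  have hc0 : c ≠ 0 := by simpa using hc 0
  have hs0 : s ≠ 0 := by simpa using hs 0
  refine ⟨-B * (s + 1) / c, fun z hz => ?_⟩
  have hzb : ‖z‖ < 1 := by simpa using hz.1
  have hzb' : ‖1 - z‖ < 1 := by simpa using (one_sub_mem_lens hz).1
  have hz0 := mem_slitPlane_of_mem_ball_one hz.2
  have hz1 := mem_slitPlane_of_mem_ball_one (one_sub_mem_lens hz).2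
  have hd : HasDerivAt (fun w : ℂ => 1 - w) (-1) z := by
    simpa using (hasDerivAt_id z).const_sub 1
  have h1 : HasDerivAt (solOne a b (c + 1)) (-c * solOne a b c z) z := by
    refine ((hd.cpow_const (c := c + 1 - 1) hz1).mul
      ((hasDerivAt_hyp2F1 a b (c + 1) hzb').comp z hd)).congr_deriv ?_
    simp only [Function.comp_apply, solOne, add_sub_cancel_right]
    rw [cpow_eq_cpow_sub_one_mul (slitPlane_ne_zero hz1) c]
    linear_combination -(1 - z) ^ (c - 1) * hyp2F1_contiguous a b c hc hzb'
  have h2 : HasDerivAt (solReg a b (c + 1) (s + 1))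
      ((c - a) * (c - b) / (-s) * solReg a b c s z) z := by
    refine (hasDerivAt_hyp2F1 _ _ _ hzb).congr_deriv ?_
    rw [solReg, show a - (c + 1) + 1 = a - c by ring, show b - (c + 1) + 1 = b - c by ring,
      show 1 - (s + 1) = -s by ring, show -s + 1 = 1 - s by ring]
    ring
  have h3 : HasDerivAt (solPow a b (s + 1)) ((s + 1) * solPow a b s z) z := by
    have hp : HasDerivAt (fun w : ℂ => w ^ (s + 1)) ((s + 1) * z ^ (s + 1 - 1)) z := by
      simpa using (hasDerivAt_id z).cpow_const (c := s + 1) hz0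
    refine (hp.mul (hasDerivAt_hyp2F1 _ _ _ hzb)).congr_deriv ?_
    have := hyp2F1_contiguous (1 - b) (1 - a) (1 + s)
      (fun n h => hs (-n - 1) (by push_cast; linear_combination h)) hzb
    rw [cpow_eq_cpow_sub_one_mul (slitPlane_ne_zero hz0) (s + 1), add_sub_cancel_right, solPow,
      show 1 + (s + 1) = 1 + s + 1 by ring]
    linear_combination z ^ s * this
  have h4 := h1.unique (((h2.const_mul A).add (h3.const_mul B)).congr_of_eventuallyEq (by
    filter_upwards [isOpen_lens.mem_nhds hz] with w hw using hB w hw))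
  have h5 : c * s * solOne a b c z = A * ((c - a) * (c - b)) * solReg a b c s z
      - B * (s + 1) * s * solPow a b s z := by
    have : s * (s⁻¹) = 1 := mul_inv_cancel₀ hs0
    rw [div_neg, div_eq_mul_inv] at h4
    linear_combination -s * h4 + A * ((c - a) * (c - b)) * solReg a b c s z * this
  field_simp
  linear_combination h5

lemma HasConn.of_add_natCast {a b c s : ℂ} (hc : ∀ n : ℕ, c ≠ -n) (hs : ∀ n : ℤ, s ≠ n)
    (n : ℕ) {A : ℂ} (h : HasConn a b (c + n) (s + n) A) :
    HasConn a b c s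
      (A * (poch (c - a) n * poch (c - b) n / (poch c n * poch s n))) := by
  induction n generalizing A with
  | zero => simpa [poch_zero] using h
  | succ n ih =>
    have h1 : HasConn a b (c + n) (s + n) _ := HasConn.of_succ
      (fun m hm => hc (n + m) (by push_cast; linear_combination hm))
      (fun m hm => hs (m - n) (by push_cast; linear_combination hm))
      (by simpa [add_assoc] using h)
    convert ih h1 using 1
    simp only [poch_succ, div_eq_mul_inv, mul_inv]
    ring

lemma tendsto_poch_inv (c : ℂ) (k : ℕ) :
    Tendsto (fun n : ℕ => (poch (c + n) k)⁻¹) atTop (𝓝 (if k = 0 then 1 else 0)) := by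
  induction k with
  | zero => simp [poch_zero]
  | succ k ih =>
    have h : Tendsto (fun n : ℕ => (c + n + k)⁻¹) atTop (𝓝 0) := by
      refine tendsto_inv₀_cobounded.comp (tendsto_norm_atTop_iff_cobounded.1 ?_)
      refine tendsto_atTop_mono (fun n => re_le_norm (c + n + k)) ?_
      simp only [add_re, natCast_re]
      exact tendsto_atTop_add_const_right _ _
        (tendsto_atTop_add_const_left _ _ tendsto_natCast_atTop_atTop)
    simpa [poch_succ, mul_inv] using h.mul ih

lemma factorial_le_norm_poch {c : ℂ} (hc : 1 ≤ c.re) (k : ℕ) :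
    (k.factorial : ℝ) ≤ ‖poch c k‖ := by
  induction k with
  | zero => simp [poch_zero]
  | succ k ih =>
    rw [poch_succ, norm_mul, Nat.factorial_succ, Nat.cast_mul, mul_comm]
    gcongr
    have := re_le_norm (c + k)
    simp only [add_re, natCast_re] at this
    push_cast
    linarith

lemma tendsto_hyp2F1_add_natCast (a b c : ℂ) {z : ℂ} (hz : ‖z‖ < 1) :
    Tendsto (fun n : ℕ => hyp2F1 a b (c + n) z) atTop (𝓝 1) := by
  have hsum := (summable_hypCoeff_mul_pow a b 1 hz).norm
  have h1 : (∑' k : ℕ, if k = 0 then (1 : ℂ) else 0) = 1 := by simp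
  rw [← h1]
  refine tendsto_tsum_of_dominated_convergence hsum (fun k => ?_) ?_
  · have := ((tendsto_poch_inv c k).const_mul (poch a k * poch b k)).mul_const
      ((k.factorial : ℂ)⁻¹ * z ^ k)
    simp only [div_eq_mul_inv, mul_inv]
    convert this using 2
    · ring
    · split_ifs with hk
      · simp [hk, poch_zero]
      · simp
  · obtain ⟨N, hN⟩ := exists_nat_ge (1 - c.re)
    filter_upwards [eventually_ge_atTop N] with n hn k
    have hre : 1 ≤ (c + n).re := by
      have : (N : ℝ) ≤ n := by exact_mod_cast hn
      simp only [add_re, natCast_re]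
      linarith
    have h := factorial_le_norm_poch hre k
    have hf : (0 : ℝ) < k.factorial := by exact_mod_cast k.factorial_pos
    have hp1 : poch 1 k = k.factorial := by simp [poch, ascPochhammer_eval_one]
    simp only [hypCoeff, norm_mul, norm_div, hp1, norm_natCast]
    gcongr

lemma tendsto_connHalf (a b c s : ℂ) :
    Tendsto (fun n : ℕ => connHalf a b (c + n) (s + n)) atTop (𝓝 1) := by
  have hh : ‖(1 / 2 : ℂ)‖ < 1 := by norm_num
  have hF := tendsto_hyp2F1_add_natCast a b c hh
  have hF' := tendsto_hyp2F1_add_natCast (a + 1) (b + 1) (c + 1) hh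
  have hw := tendsto_hyp2F1_add_natCast (1 - b) (1 - a) (1 + s) hh
  have hw' := tendsto_hyp2F1_add_natCast (1 - b + 1) (1 - a + 1) (1 + s + 1) hh
  have hi : ∀ t : ℂ, Tendsto (fun n : ℕ => (t + n)⁻¹) atTop (𝓝 0) := fun t => by
    simpa [poch_succ, poch_zero] using tendsto_poch_inv t 1
  have hr := tendsto_add_natCast_div (c - 1) s
  have key := ((hF.const_mul (1 / 2)).mul (hw.add
      ((((hw'.const_mul ((1 - b) * (1 - a))).mul (hi (1 + s))).mul (hi s)).const_mul (1 / 2)))).add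
    (((hr.mul hF).add ((((hF'.const_mul (a * b)).mul (hi c)).mul (hi s)).const_mul (1 / 2))).mul
      (hw.const_mul (1 / 2)))
  convert key using 2 with n
  · simp only [connHalf, div_eq_mul_inv]
    rw [show c + n - 1 = c - 1 + n by ring, show 1 + (s + n) = 1 + s + n by ring,
      show 1 + s + n + 1 = 1 + s + 1 + n by ring, show c + n + 1 = c + 1 + n by ring]
    ring
  · norm_num

lemma prod_range_eq_poch (z : ℂ) (n : ℕ) : ∏ j ∈ Finset.range n, (z + j) = poch z n := by
  induction n with
  | zero => simp [poch_zero]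
  | succ n ih => rw [Finset.prod_range_succ, ih, poch_succ]

lemma tendsto_GammaSeq_inv (z : ℂ) :
    Tendsto (fun n => (GammaSeq z n)⁻¹) atTop (𝓝 (Gamma z)⁻¹) := by
  by_cases h : Gamma z = 0
  · obtain ⟨m, hm⟩ := (Gamma_eq_zero_iff z).1 h
    rw [h, inv_zero]
    refine tendsto_const_nhds.congr' ?_
    filter_upwards [eventually_ge_atTop m] with n hn
    rw [GammaSeq, Finset.prod_eq_zero (i := m) (Finset.mem_range.2 (by omega)) (by simp [hm])]
    simp
  · exact (GammaSeq_tendsto_Gamma z).inv₀ h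

lemma tendsto_poch_ratio {c s p q : ℂ} (h : c + s = p + q) :
    Tendsto (fun n : ℕ => poch p n * poch q n / (poch c n * poch s n)) atTop
      (𝓝 (Gamma c * Gamma s / (Gamma p * Gamma q))) := by
  rw [← tendsto_add_atTop_iff_nat 1]
  have key := ((GammaSeq_tendsto_Gamma c).mul (GammaSeq_tendsto_Gamma s)).mul
    ((tendsto_GammaSeq_inv p).mul (tendsto_GammaSeq_inv q))
  rw [← mul_inv, ← div_eq_mul_inv] at key
  refine key.congr' ?_
  filter_upwards [eventually_ne_atTop 0] with n hn
  have hn0 : (n : ℂ) ≠ 0 := Nat.cast_ne_zero.2 hn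
  have hf : (n.factorial : ℂ) ≠ 0 := Nat.cast_ne_zero.2 n.factorial_ne_zero
  have e : (n : ℂ) ^ c * n ^ s = n ^ p * n ^ q := by
    rw [← cpow_add _ _ hn0, ← cpow_add _ _ hn0, h]
  have hp : (n : ℂ) ^ p ≠ 0 := by simp [cpow_eq_zero_iff, hn0]
  have hq : (n : ℂ) ^ q ≠ 0 := by simp [cpow_eq_zero_iff, hn0]
  simp only [GammaSeq, prod_range_eq_poch, inv_div]
  rw [div_mul_div_comm, div_mul_div_comm, div_mul_div_comm,
    show (n : ℂ) ^ c * n.factorial * (n ^ s * n.factorial)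
      = (n ^ p * n.factorial) * (n ^ q * n.factorial) by linear_combination n.factorial ^ 2 * e,
    mul_comm (poch c _ * poch s _), mul_div_mul_left]
  positivity

lemma hasConn_Gamma (a b c s : ℂ) (hc : ∀ n : ℕ, c ≠ -n) (hs : ∀ n : ℤ, s ≠ n)
    (hsc : s = c - a - b) :
    HasConn a b c s (Gamma c * Gamma s / (Gamma (c - a) * Gamma (c - b))) := by
  have hn : ∀ n : ℕ, HasConn a b c s (connHalf a b (c + n) (s + n) *
      (poch (c - a) n * poch (c - b) n / (poch c n * poch s n))) := fun n =>
    HasConn.of_add_natCast hc hs n (hasConn_connHalf a b (c + n) (s + n)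
      (fun m hm => hc (n + m) (by push_cast; linear_combination hm))
      (fun m hm => hs (m - n) (by push_cast; linear_combination hm))
      (by rw [hsc]; ring))
  have hlim := (tendsto_connHalf a b c s).mul
    (tendsto_poch_ratio (c := c) (s := s) (p := c - a) (q := c - b) (by rw [hsc]; ring))
  rw [one_mul] at hlim
  have hconst : Tendsto (fun n : ℕ => connHalf a b (c + n) (s + n) *
      (poch (c - a) n * poch (c - b) n / (poch c n * poch s n))) atTop (𝓝 _) :=
    tendsto_const_nhds.congr fun n => (hn 0).unique hs hsc (hn n)
  rw [← tendsto_nhds_unique hconst hlim]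
  exact hn 0

/-- Half of the connection formula: the coefficient of the solution regular at the origin. -/
lemma exists_connection (a b c s : ℂ) (hc : ∀ n : ℕ, c ≠ -n) (hs : ∀ n : ℤ, s ≠ n)
    (hsc : s = c - a - b) :
    ∃ B : ℂ, ∀ z ∈ lens, hyp2F1 a b c (1 - z) =
      Gamma c * Gamma s / (Gamma (c - a) * Gamma (c - b)) * hyp2F1 a b (1 - s) z
        + B * (z ^ s * hyp2F1 (c - a) (c - b) (1 + s) z) := by
  obtain ⟨B, hB⟩ := hasConn_Gamma a b c s hc hs hsc
  refine ⟨B, fun z hz => ?_⟩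
  have h := hB z hz
  have hz1 : 1 - z ≠ 0 :=
    slitPlane_ne_zero (mem_slitPlane_of_mem_ball_one (one_sub_mem_lens hz).2)
  have e1 := hyp2F1_euler a b (1 - s)
    (fun n h => hs (n + 1) (by push_cast; linear_combination -h)) hz.1
  have e2 := hyp2F1_euler (c - a) (c - b) (1 + s)
    (fun n h => hs (-n - 1) (by push_cast; linear_combination h)) hz.1
  have e3 : (1 - z) ^ (1 - c) * (1 - z) ^ (c - 1) = 1 := by
    rw [← cpow_add _ _ hz1, show 1 - c + (c - 1) = 0 by ring, cpow_zero]
  rw [show 1 - s - a - b = 1 - c by rw [hsc]; ring, hyp2F1_comm,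
    show 1 - s - a = b - c + 1 by rw [hsc]; ring,
    show 1 - s - b = a - c + 1 by rw [hsc]; ring, hyp2F1_comm, hyp2F1_comm (b - c + 1)] at e1
  rw [show 1 + s - (c - a) - (c - b) = 1 - c by rw [hsc]; ring,
    show 1 + s - (c - a) = 1 - b by rw [hsc]; ring,
    show 1 + s - (c - b) = 1 - a by rw [hsc]; ring] at e2
  rw [e1, e2]
  simp only [solOne, solReg, solPow] at h
  linear_combination (1 - z) ^ (1 - c) * h - hyp2F1 a b c (1 - z) * e3

lemma frobenius_independent {a b c s A B : ℂ} (hs : ∀ n : ℤ, s ≠ n) (hsc : s = c - a - b)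
    (h : ∀ z ∈ lens, A * hyp2F1 a b (1 - s) z +
      B * (z ^ s * hyp2F1 (c - a) (c - b) (1 + s) z) = 0) : A = 0 ∧ B = 0 := by
  refine sol_independent (a := 1 - c + a) (b := 1 - c + b) (c := 2 - c) hs
    (by rw [hsc]; ring) fun z hz => ?_
  rw [← h z hz, hyp2F1_comm (c - a)]
  simp only [solReg, solPow]
  ring_nf

/-- The connection formula between the solutions at `0` and at `1`. -/
theorem hyp2F1_one_sub (a b c s : ℂ) (hc : ∀ n : ℕ, c ≠ -n) (hs : ∀ n : ℤ, s ≠ n)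
    (hsc : s = c - a - b) {z : ℂ} (hz : z ∈ lens) :
    hyp2F1 a b c (1 - z) =
      Gamma c * Gamma s / (Gamma (c - a) * Gamma (c - b)) * hyp2F1 a b (1 - s) z
        + Gamma c * Gamma (-s) / (Gamma a * Gamma b) *
          (z ^ s * hyp2F1 (c - a) (c - b) (1 + s) z) := by
  obtain ⟨B, hB⟩ := exists_connection a b c s hc hs hsc
  obtain ⟨B', hB'⟩ := exists_connection (c - a) (c - b) c (-s) hc
    (fun n h => hs (-n) (by push_cast; linear_combination -h)) (by rw [hsc]; ring)
  simp only [sub_sub_cancel, sub_neg_eq_add, ← sub_eq_add_neg] at hB'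
  have hind := frobenius_independent (a := a) (b := b)
    (A := Gamma c * Gamma s / (Gamma (c - a) * Gamma (c - b)) - B')
    (B := B - Gamma c * Gamma (-s) / (Gamma a * Gamma b)) hs hsc fun w hw => by
      have hw0 : w ≠ 0 := by
        simpa using slitPlane_ne_zero
          (mem_slitPlane_of_mem_ball_one (one_sub_mem_lens (one_sub_mem_lens hw)).2)
      have he := hyp2F1_euler a b c hc (one_sub_mem_lens hw).1
      rw [sub_sub_cancel, ← hsc] at he
      have hp : w ^ s * w ^ (-s) = 1 := by
        rw [← cpow_add _ _ hw0, add_neg_cancel, cpow_zero]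
      linear_combination he - hB w hw + w ^ s * hB' w hw + B' * hyp2F1 a b (1 - s) w * hp
  rw [hB z hz, sub_eq_zero.1 hind.2]

theorem stmt3 (p : ℝ) (hp : -1 < p) (q α : ℂ) (hα : ∀ n : ℤ, 2 * α ≠ (n : ℂ)) :
    ∀ x ∈ Ioo (0 : ℝ) 1,
      thetaJ (p : ℂ) q α x
        = (1 / 2) * (QJ (p : ℂ) q α * Gcb (p : ℂ) q α x
            + QJ (p : ℂ) q (-α) * Gcb (p : ℂ) q (-α) x) := by
  intro x hx
  have hx0 : (x : ℂ) ≠ 0 := ofReal_ne_zero.2 hx.1.ne'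
  have hc : ∀ n : ℕ, (1 + p : ℂ) ≠ -n := fun n h => by
    have hre := congrArg re h
    simp only [add_re, one_re, ofReal_re, neg_re, natCast_re] at hre
    have : (0 : ℝ) ≤ n := n.cast_nonneg
    linarith
  have key := hyp2F1_one_sub ((1 + p + q) / 2 + α) ((1 + p - q) / 2 + α) (1 + p) (-2 * α) hc
    (fun n h => hα (-n) (by push_cast; linear_combination -h)) (by ring) (ofReal_mem_lens hx)
  have hpow : (x : ℂ) ^ ((1 + p + q) / 2 + -α)
      = (x : ℂ) ^ ((1 + p + q) / 2 + α) * (x : ℂ) ^ (-2 * α) := by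
    rw [← cpow_add _ _ hx0]
    ring_nf
  rw [show (1 + p : ℂ) - ((1 + p + q) / 2 + α) = (1 + p - q) / 2 - α by ring,
    show (1 + p : ℂ) - ((1 + p - q) / 2 + α) = (1 + p + q) / 2 - α by ring,
    show 1 - -2 * α = 1 + 2 * α by ring, hyp2F1_comm ((1 + p - q) / 2 - α)] at key
  simp only [thetaJ, Gcb, QJ]
  rw [key, hpow, sub_neg_eq_add, sub_neg_eq_add, ← sub_eq_add_neg, ← sub_eq_add_neg,
    show 1 + 2 * -α = 1 + -2 * α by ring, show -2 * -α = -(-2 * α) by ring,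
    mul_comm (Gamma ((1 + p - q) / 2 - α))]
  ring
end
end

section
/- Let d, Δ₁, Δ₂ be real, h=d/2, Δ₋=(Δ₁−Δ₂)/2, and let f be twice differentiable on (0,1). Then for all η∈(0,1): (1/4)·(D_proj f)(η) = η^{−Δ₋} · [ (D_{h−1, 2Δ₋} g)(η) + Δ₋(Δ₋+h)·g(η) ], where g(y) = y^{Δ₋} f(y). That is, the crosscap Casimir operator is conjugate to the Jacobi operator with parameters (p,q)=(h−1, 2Δ₋) shifted by the constant Δ₋(Δ₋+h). -/
open scoped Real
open Complex MeasureTheory Set ComplexConjugate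

noncomputable section

/-- The Jacobi operator `D_{p,q}` acting on functions on `(0,1)`. -/
def jacobiOp (p q : ℂ) (f : ℝ → ℂ) (x : ℝ) : ℂ :=
  -(p + q + (1 - q) * (x : ℂ)) * (x : ℂ) * deriv f x
    + (1 - (x : ℂ)) * (x : ℂ) ^ 2 * deriv (deriv f) x

/-- The crosscap Casimir operator `D_proj` (with `h = d/2`, `Δm = Δ₋`). -/
def Dproj (h Δm : ℝ) (f : ℝ → ℂ) (η : ℝ) : ℂ :=
  4 * (η : ℂ) ^ ((h + 1 : ℝ) : ℂ) * (1 - (η : ℂ)) ^ ((1 - h : ℝ) : ℂ) *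
      deriv (fun y : ℝ =>
        (1 - (y : ℂ)) ^ ((h : ℝ) : ℂ) * (y : ℂ) ^ ((1 - h : ℝ) : ℂ) * deriv f y) η
    + 4 * (Δm : ℂ) ^ 2 * (η : ℂ) * f η

/-- Derivative of a complex power of a positive real variable. -/
theorem hasDerivAt_ofReal_cpow_of_pos {x : ℝ} (hx : 0 < x) (c : ℂ) :
    HasDerivAt (fun y : ℝ => (y : ℂ) ^ c) (c * (x : ℂ) ^ c / x) x := by
  have hne : (x : ℂ) ≠ 0 := ofReal_ne_zero.mpr hx.ne'
  have h := ((hasDerivAt_id (x : ℂ)).cpow_const (c := c) (ofReal_mem_slitPlane.mpr hx)).comp_ofReal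
  refine h.congr_deriv ?_
  simp only [id, cpow_sub _ _ hne, cpow_one]
  ring

/-- Derivative of a complex power of `1 - y`, for real `y` less than `1`. -/
theorem hasDerivAt_one_sub_ofReal_cpow {x : ℝ} (hx : x < 1) (c : ℂ) :
    HasDerivAt (fun y : ℝ => (1 - (y : ℂ)) ^ c) (-(c * (1 - (x : ℂ)) ^ c / (1 - x))) x := by
  have h := (hasDerivAt_ofReal_cpow_of_pos (sub_pos.mpr hx) c).scomp x
    ((hasDerivAt_id x).const_sub 1)
  simpa [Function.comp_def] using h

theorem stmt10 (d Δ₁ Δ₂ h Δm : ℝ) (hh : h = d / 2) (hm : Δm = (Δ₁ - Δ₂) / 2)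
    (f : ℝ → ℂ)
    (hf : ∀ x ∈ Ioo (0 : ℝ) 1, DifferentiableAt ℝ f x)
    (hf' : ∀ x ∈ Ioo (0 : ℝ) 1, DifferentiableAt ℝ (deriv f) x) :
    ∀ η ∈ Ioo (0 : ℝ) 1,
      (1 / 4 : ℂ) * Dproj h Δm f η
        = (η : ℂ) ^ ((-Δm : ℝ) : ℂ) *
            (jacobiOp ((h - 1 : ℝ) : ℂ) ((2 * Δm : ℝ) : ℂ)
                (fun y => (y : ℂ) ^ ((Δm : ℝ) : ℂ) * f y) η
              + (Δm : ℂ) * ((Δm + h : ℝ) : ℂ) * (η : ℂ) ^ ((Δm : ℝ) : ℂ) * f η) := by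
  intro η hη
  obtain ⟨h0, h1⟩ := hη
  have hx : (η : ℂ) ≠ 0 := ofReal_ne_zero.mpr h0.ne'
  have hy : (1 - (η : ℂ)) ≠ 0 := by
    exact_mod_cast (sub_pos.mpr h1).ne'
  have dg : ∀ y ∈ Ioo (0 : ℝ) 1, HasDerivAt (fun y : ℝ => (y : ℂ) ^ (Δm : ℂ) * f y)
      (Δm * (y : ℂ) ^ (Δm : ℂ) / y * f y + (y : ℂ) ^ (Δm : ℂ) * deriv f y) y := fun y hy =>
    (hasDerivAt_ofReal_cpow_of_pos hy.1 _).fun_mul (hf y hy).hasDerivAt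
  have eg : deriv (fun y : ℝ => (y : ℂ) ^ (Δm : ℂ) * f y) =ᶠ[nhds η] fun y : ℝ =>
      Δm * (y : ℂ) ^ (Δm : ℂ) / y * f y + (y : ℂ) ^ (Δm : ℂ) * deriv f y := by
    filter_upwards [Ioo_mem_nhds h0 h1] with y hy using (dg y hy).deriv
  have df := (hf η ⟨h0, h1⟩).hasDerivAt
  have df' := (hf' η ⟨h0, h1⟩).hasDerivAt
  have dpow := hasDerivAt_ofReal_cpow_of_pos h0 (Δm : ℂ)
  have dgg := (((dpow.const_mul (Δm : ℂ)).fun_div (hasDerivAt_id η).ofReal_comp hx).fun_mul df).fun_add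
    (dpow.fun_mul df')
  have dD := ((hasDerivAt_one_sub_ofReal_cpow h1 (h : ℂ)).fun_mul
    (hasDerivAt_ofReal_cpow_of_pos h0 ((1 - h : ℝ) : ℂ))).fun_mul df'
  have hA : (η : ℂ) ^ (Δm : ℂ) ≠ 0 := by simp [cpow_eq_zero_iff, hx]
  have hH : (η : ℂ) ^ (h : ℂ) ≠ 0 := by simp [cpow_eq_zero_iff, hx]
  have hB : (1 - (η : ℂ)) ^ (h : ℂ) ≠ 0 := by simp [cpow_eq_zero_iff, hy]
  have eD := dD.deriv
  have egg := eg.deriv_eq.trans dgg.deriv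
  simp only [Dproj, jacobiOp]
  rw [eD, egg, (dg η ⟨h0, h1⟩).deriv]
  simp only [id, ofReal_sub, ofReal_add, ofReal_neg, ofReal_mul, ofReal_one, ofReal_ofNat,
    cpow_sub _ _ hx, cpow_sub _ _ hy, cpow_add _ _ hx, cpow_neg, cpow_one]
  field_simp
  ring
end
end
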